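/- For all a, y > 0 the limit ψ^C(a,y) := lim_{n→∞} (1/(2n)) log P^C_{2n}(a,y) exists, and ψ^C(a,y) = log 2 if a ≤ 2 and y ≤ 1; ψ^C(a,y) = (1/2)log 2 + (1/2)log a − (1/4)log(a−1) if a > 2 and y ≤ 1; ψ^C(a,y) = log(y+1) − (1/2)log y if y > 1 and a ≤ y + 1; and ψ^C(a,y) = (1/2)log a − (1/4)log(a−1) + (1/2)log(y+1) − (1/4)log y if y > 1 and a > y + 1. -/

import Mathlib

open Finset Filter

attribute [local instance] Classical.propDecidable

/-- Height (second coordinate) of a binomial path after `i` steps, starting at height `c`;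
steps are encoded by `s : Fin n → Bool` (`true` = up step `(1,1)`, `false` = down step `(1,-1)`).
The path visits the points `(x₀ + i, hgt c s i)` for `0 ≤ i ≤ n`. -/
def hgt {n : ℕ} (c : ℤ) (s : Fin n → Bool) (i : ℕ) : ℤ :=
  c + ∑ j ∈ Finset.range i, (if h : j < n then (if s ⟨j, h⟩ then (1 : ℤ) else -1) else 0)

/-- The path lies in the upper half-plane (all second coordinates ≥ 0). -/
def InUHP {n : ℕ} (c : ℤ) (s : Fin n → Bool) : Prop :=
  ∀ i ≤ n, 0 ≤ hgt c s i

/-- The number of vertices of the path with second coordinate 0. -/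
def visits {n : ℕ} (c : ℤ) (s : Fin n → Bool) : ℕ :=
  ((Finset.range (n + 1)).filter (fun i => hgt c s i = 0)).card

/-- `(c, sp, sm)` encodes a staircase polygon of length `2n` in `𝒫^S_{2n}`:
both binomial paths of length `n` start at `(0, c)` (so the leftmost vertex has first
coordinate `0`), they end at the same point, the upper path `sp` is strictly above the
lower path `sm` at the intermediate points, the polygon lies in the upper half-plane,
and it has at least one vertex with second coordinate `0`. -/
def IsStaircase {n : ℕ} (c : ℤ) (sp sm : Fin n → Bool) : Prop :=
  hgt c sp n = hgt c sm n ∧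
  (∀ i, 0 < i → i < n → hgt c sm i < hgt c sp i) ∧
  InUHP c sp ∧ InUHP c sm ∧
  (∃ i ≤ n, hgt c sp i = 0 ∨ hgt c sm i = 0)

/-- `P^C_{2n}(a,y)`: partition function of centred staircase polygons of length `2n`,
i.e. those with `π⁻_{⌊n/2⌋}` having second coordinate `0`. -/
noncomputable def PC (n : ℕ) (a y : ℝ) : ℝ :=
  ∑ p ∈ (Finset.univ : Finset (Fin (n + 1) × (Fin n → Bool) × (Fin n → Bool))).filter
      (fun p => IsStaircase ((p.1 : ℕ) : ℤ) p.2.1 p.2.2 ∧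
        hgt ((p.1 : ℕ) : ℤ) p.2.2 (n / 2) = 0),
    a ^ visits ((p.1 : ℕ) : ℤ) p.2.2 * y ^ hgt ((p.1 : ℕ) : ℤ) p.2.1 (n / 2)


/-! ### Generic weighted walk kernels -/

section generic
variable {X : Type*} [AddCommGroup X]

noncomputable def Kern (S : Finset X) (w : X → ℝ) : ℕ → X → X → ℝ
  | 0, x, z => if x = z then 1 else 0
  | k + 1, x, z => ∑ s ∈ S, w (x + s) * Kern S w k (x + s) z

noncomputable def VV (S : Finset X) (φ : ℕ → X → ℝ) : ℕ → ℕ → X → ℝ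
  | 0, _, _ => 1
  | k + 1, i, x => ∑ s ∈ S, φ (i + 1) (x + s) * VV S φ k (i + 1) (x + s)

lemma Kern_nonneg (S : Finset X) (w : X → ℝ) (hw : ∀ x, 0 ≤ w x) (k : ℕ) (x z : X) :
    0 ≤ Kern S w k x z := by
  induction k generalizing x with
  | zero => simp only [Kern]; split_ifs <;> norm_num
  | succ k ih => exact Finset.sum_nonneg fun s _ => mul_nonneg (hw _) (ih _)

lemma VV_nonneg (S : Finset X) (φ : ℕ → X → ℝ) (hφ : ∀ i x, 0 ≤ φ i x) (k i : ℕ) (x : X) :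
    0 ≤ VV S φ k i x := by
  induction k generalizing x i with
  | zero => simp [VV]
  | succ k ih => exact Finset.sum_nonneg fun s _ => mul_nonneg (hφ _ _) (ih _ _)

lemma Kern_chain (S : Finset X) (w : X → ℝ) (hw : ∀ x, 0 ≤ w x) (i j : ℕ) (x y z : X) :
    Kern S w i x y * Kern S w j y z ≤ Kern S w (i + j) x z := by
  induction i generalizing x with
  | zero =>
    simp only [Kern, Nat.zero_add]
    split_ifs with h
    · simp [h]
    · simpa using Kern_nonneg S w hw j x z
  | succ i ih =>
    rw [show i + 1 + j = (i + j) + 1 by omega]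
    simp only [Kern]
    rw [Finset.sum_mul]
    refine Finset.sum_le_sum fun s _ => ?_
    rw [mul_assoc]
    exact mul_le_mul_of_nonneg_left (ih _) (hw _)

lemma Kern_right (S : Finset X) (w : X → ℝ) (k : ℕ) (x z : X) :
    Kern S w (k + 1) x z = ∑ s ∈ S, Kern S w k x (z - s) * w z := by
  induction k generalizing x with
  | zero =>
    simp only [Kern]
    refine Finset.sum_congr rfl fun s _ => ?_
    by_cases h : x + s = z
    · have : x = z - s := by rw [← h]; abel
      simp [h, ← this]
    · have : ¬ x = z - s := by rintro rfl; exact h (by abel)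
      simp [h, this]
  | succ k ih =>
    rw [Kern]
    simp_rw [ih, Finset.mul_sum]
    rw [Finset.sum_comm]
    refine Finset.sum_congr rfl fun s _ => ?_
    rw [Kern, Finset.sum_mul]
    refine Finset.sum_congr rfl fun s' _ => ?_
    ring

lemma Kern_rev (S : Finset X) (hS : ∀ s ∈ S, -s ∈ S) (w : X → ℝ) (k : ℕ) (x z : X) :
    w x * Kern S w k x z = w z * Kern S w k z x := by
  induction k generalizing x with
  | zero =>
    simp only [Kern]
    by_cases h : x = z
    · simp [h]
    · simp [h, Ne.symm h]
  | succ k ih =>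
    rw [Kern_right S w k z x, Kern, Finset.mul_sum, Finset.mul_sum]
    refine Finset.sum_bij' (fun s _ => -s) (fun s _ => -s) (fun s h => hS s h) (fun s h => hS s h)
      (by simp) (by simp) ?_
    intro s _
    rw [ih, sub_neg_eq_add]; ring

lemma Kern_trans (S : Finset X) (w : X → ℝ) (v : X) (hv : ∀ x, w (x + v) = w x) (k : ℕ) (x z : X) :
    Kern S w k (x + v) (z + v) = Kern S w k x z := by
  induction k generalizing x with
  | zero => simp [Kern]
  | succ k ih =>
    simp only [Kern]
    refine Finset.sum_congr rfl fun s _ => ?_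
    rw [add_right_comm, hv, ih]

lemma Kern_straight (S : Finset X) (w : X → ℝ) (hw : ∀ x, 0 ≤ w x) (s : X) (hs : s ∈ S) (ω : ℝ)
    (hω : 0 ≤ ω) (j : ℕ) (x z : X) (hz : z = x + j • s)
    (h : ∀ i : ℕ, 1 ≤ i → i ≤ j → ω ≤ w (x + i • s)) :
    ω ^ j ≤ Kern S w j x z := by
  induction j generalizing x with
  | zero => simp [Kern, hz]
  | succ j ih =>
    rw [Kern]
    refine le_trans ?_ (Finset.single_le_sum (f := fun s => w (x + s) * Kern S w j (x + s) z)
      (fun s _ => mul_nonneg (hw _) (Kern_nonneg S w hw j _ _)) hs)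
    rw [pow_succ']
    have h1 := h 1 le_rfl (by omega)
    rw [one_smul] at h1
    refine mul_le_mul h1 (ih (x + s) ?_ ?_) (by positivity) (hw _)
    · rw [hz, succ_nsmul']; abel
    · intro i hi hij
      have := h (i + 1) (by omega) (by omega)
      rwa [succ_nsmul', ← add_assoc] at this

lemma Kern_pow (S : Finset X) (w : X → ℝ) (hw : ∀ x, 0 ≤ w x) (L : ℕ) (R : ℝ) (hR : 0 ≤ R)
    (p : ℕ → X) (q : ℕ) (h : ∀ i, i < q → R ≤ Kern S w L (p i) (p (i + 1))) :
    R ^ q ≤ Kern S w (q * L) (p 0) (p q) := by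
  induction q with
  | zero => simp [Kern]
  | succ q ih =>
    rw [Nat.succ_mul, pow_succ]
    refine le_trans ?_ (Kern_chain S w hw _ _ _ (p q) _)
    exact mul_le_mul (ih fun i hi => h i (by omega)) (h q (by omega)) hR (Kern_nonneg S w hw _ _ _)

lemma VV_chain (S : Finset X) (w : X → ℝ) (φ : ℕ → X → ℝ) (hw : ∀ x, 0 ≤ w x)
    (hφ : ∀ i x, 0 ≤ φ i x) (κ : ℝ) (y : X) (k j i : ℕ) (x : X)
    (h1 : ∀ i' x, i < i' → i' < i + (k + 1) → w x ≤ φ i' x)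
    (h2 : κ * w y ≤ φ (i + (k + 1)) y) :
    κ * Kern S w (k + 1) x y * VV S φ j (i + (k + 1)) y ≤ VV S φ (k + 1 + j) i x := by
  induction k generalizing x i with
  | zero =>
    rw [show 0 + 1 + j = j + 1 by omega]
    simp only [VV, Kern, Nat.zero_add]
    rw [Finset.mul_sum, Finset.sum_mul]
    refine Finset.sum_le_sum fun s _ => ?_
    by_cases h : x + s = y
    · simp only [h, if_true]
      rw [mul_one]
      exact mul_le_mul_of_nonneg_right h2 (VV_nonneg S φ hφ _ _ _)
    · simp only [h, if_false, mul_zero, zero_mul]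
      exact mul_nonneg (hφ _ _) (VV_nonneg S φ hφ _ _ _)
  | succ k ih =>
    rw [show k + 1 + 1 + j = (k + 1 + j) + 1 by omega, Kern, VV]
    rw [Finset.mul_sum, Finset.sum_mul]
    refine Finset.sum_le_sum fun s _ => ?_
    have e : i + (k + 1 + 1) = (i + 1) + (k + 1) := by omega
    have := ih (i + 1) (x + s) (fun i' x a b => h1 i' x (by omega) (by omega)) (by rwa [← e])
    have h3 := VV_nonneg S φ hφ (k + 1 + j) (i + 1) (x + s)
    rw [e]
    calc κ * (w (x + s) * Kern S w (k + 1) (x + s) y) * VV S φ j (i + 1 + (k + 1)) y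
        = w (x + s) * (κ * Kern S w (k + 1) (x + s) y * VV S φ j (i + 1 + (k + 1)) y) := by ring
      _ ≤ w (x + s) * VV S φ (k + 1 + j) (i + 1) (x + s) := mul_le_mul_of_nonneg_left this (hw _)
      _ ≤ _ := mul_le_mul_of_nonneg_right (h1 _ _ (by omega) (by omega)) h3

/-- Upper bound through a superharmonic function. -/
lemma VV_upper (S : Finset X) (φ G : ℕ → X → ℝ) (hφ : ∀ i x, 0 ≤ φ i x) (Λ : ℝ) (n : ℕ)
    (hΛ : 0 ≤ Λ) (h0 : ∀ x, φ n x ≤ G n x)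
    (h1 : ∀ i x, i < n → φ i x * ∑ s ∈ S, G (i + 1) (x + s) ≤ Λ * G i x)
    (k i : ℕ) (hik : i + k = n) (x : X) :
    φ i x * VV S φ k i x ≤ Λ ^ k * G i x := by
  induction k generalizing x i with
  | zero => obtain rfl : i = n := by omega
            simpa [VV] using h0 x
  | succ k ih =>
    rw [VV]
    calc φ i x * ∑ s ∈ S, φ (i + 1) (x + s) * VV S φ k (i + 1) (x + s)
        ≤ φ i x * ∑ s ∈ S, Λ ^ k * G (i + 1) (x + s) :=
          mul_le_mul_of_nonneg_left
            (Finset.sum_le_sum fun s _ => ih (i + 1) (by omega) (x + s)) (hφ _ _)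
      _ = Λ ^ k * (φ i x * ∑ s ∈ S, G (i + 1) (x + s)) := by rw [← Finset.mul_sum]; ring
      _ ≤ Λ ^ k * (Λ * G i x) := mul_le_mul_of_nonneg_left (h1 i x (by omega)) (by positivity)
      _ = _ := by ring

end generic

/-! ### One-dimensional kernels -/

def S1 : Finset ℤ := {1, -1}

def S2 : Finset (ℤ × ℤ) := S1 ×ˢ S1

lemma sum_S1 (f : ℤ → ℝ) : ∑ s ∈ S1, f s = f 1 + f (-1) := by
  rw [S1, Finset.sum_pair (by norm_num)]

lemma sum_S2 (f : ℤ × ℤ → ℝ) :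
    ∑ s ∈ S2, f s = (f (1, 1) + f (1, -1)) + (f (-1, 1) + f (-1, -1)) := by
  rw [S2, Finset.sum_product, sum_S1, sum_S1, sum_S1]

lemma S1_neg : ∀ s ∈ S1, -s ∈ S1 := by decide
lemma S2_neg : ∀ s ∈ S2, -s ∈ S2 := by decide

/-- wall weight -/
noncomputable def wD (a : ℝ) (l : ℤ) : ℝ := if 0 ≤ l then (if l = 0 then a else 1) else 0

/-- pair weight -/
noncomputable def wP (a : ℝ) (x : ℤ × ℤ) : ℝ := if x.1 < x.2 then wD a x.1 else 0

lemma wD_nonneg (a : ℝ) (ha : 0 < a) (l : ℤ) : 0 ≤ wD a l := by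
  unfold wD; split_ifs <;> linarith

lemma wP_nonneg (a : ℝ) (ha : 0 < a) (x : ℤ × ℤ) : 0 ≤ wP a x := by
  unfold wP; split_ifs; exacts [wD_nonneg a ha _, le_rfl]

noncomputable def NN : ℕ → ℤ → ℤ → ℝ := Kern S1 (fun _ => 1)

noncomputable def DD (a : ℝ) : ℕ → ℤ → ℤ → ℝ := Kern S1 (wD a)

noncomputable def KK (a : ℝ) : ℕ → ℤ × ℤ → ℤ × ℤ → ℝ := Kern S2 (wP a)

lemma KK_prod (a : ℝ) (L : ℕ) (l u l' u' : ℤ) (h : l + 2 * L + 1 ≤ u) :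
    KK a L (l, u) (l', u') = DD a L l l' * NN L u u' := by
  induction L generalizing l u with
  | zero =>
    simp only [KK, DD, NN, Kern, Prod.mk.injEq]
    by_cases h1 : l = l' <;> by_cases h2 : u = u' <;> simp [h1, h2]
  | succ L ih =>
    simp only [KK, DD, NN, Kern] at ih ⊢
    push_cast at h
    rw [S2, Finset.sum_product, Finset.sum_mul_sum]
    refine Finset.sum_congr rfl fun s hs => Finset.sum_congr rfl fun s' hs' => ?_
    have h1 : s ≤ 1 ∧ -1 ≤ s' := by
      simp only [S1, Finset.mem_insert, Finset.mem_singleton] at hs hs'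
      constructor <;> omega
    have := ih (l + s) (u + s') (by omega)
    simp only [Prod.mk_add_mk]
    rw [S2] at this
    rw [this, wP, if_pos (by simp only; omega)]
    ring

lemma DD_eq_NN (a : ℝ) (L : ℕ) (l l' : ℤ) (h : (L : ℤ) + 1 ≤ l) : DD a L l l' = NN L l l' := by
  induction L generalizing l with
  | zero => simp [DD, NN, Kern]
  | succ L ih =>
    simp only [DD, NN, Kern] at ih ⊢
    push_cast at h
    refine Finset.sum_congr rfl fun s hs => ?_
    simp only [S1, Finset.mem_insert, Finset.mem_singleton] at hs
    rw [ih (l + s) (by omega), wD, if_pos (by omega), if_neg (by omega)]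

lemma NN_nonneg (k : ℕ) (x z : ℤ) : 0 ≤ NN k x z := Kern_nonneg _ _ (by simp) _ _ _

lemma NN_symm (k : ℕ) (x z : ℤ) : NN k x z = NN k z x := by
  simpa [NN] using Kern_rev S1 S1_neg (fun _ => (1 : ℝ)) k x z

lemma NN_trans (k : ℕ) (x z v : ℤ) : NN k (x + v) (z + v) = NN k x z :=
  Kern_trans S1 (fun _ => (1 : ℝ)) v (by simp) k x z

lemma Kern_sum_ge (w F : ℤ → ℝ) (hw : ∀ x, 0 ≤ w x) (Λ : ℝ) (hΛ : 0 ≤ Λ)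
    (h : ∀ x, Λ * F x ≤ ∑ s ∈ S1, w (x + s) * F (x + s)) (R : ℤ) (k : ℕ) (x : ℤ)
    (h1 : -R ≤ x - k) (h2 : x + k ≤ R) :
    Λ ^ k * F x ≤ ∑ z ∈ Finset.Icc (-R) R, Kern S1 w k x z * F z := by
  induction k generalizing x with
  | zero =>
    simp only [Kern, ite_mul, one_mul, zero_mul, pow_zero]
    rw [Finset.sum_ite_eq, if_pos]
    rw [Finset.mem_Icc]; push_cast at h1 h2; omega
  | succ k ih =>
    push_cast at h1 h2
    calc Λ ^ (k + 1) * F x = Λ ^ k * (Λ * F x) := by ring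
      _ ≤ Λ ^ k * ∑ s ∈ S1, w (x + s) * F (x + s) :=
        mul_le_mul_of_nonneg_left (h x) (by positivity)
      _ = ∑ s ∈ S1, w (x + s) * (Λ ^ k * F (x + s)) := by
        rw [Finset.mul_sum]; refine Finset.sum_congr rfl fun s _ => by ring
      _ ≤ ∑ s ∈ S1, w (x + s) * ∑ z ∈ Finset.Icc (-R) R, Kern S1 w k (x + s) z * F z := by
        refine Finset.sum_le_sum fun s hs => mul_le_mul_of_nonneg_left (ih (x + s) ?_ ?_) (hw _)
        all_goals
          simp only [S1, Finset.mem_insert, Finset.mem_singleton] at hs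
          omega
      _ = _ := by
        simp_rw [Finset.mul_sum, Kern, Finset.sum_mul]
        rw [Finset.sum_comm]
        refine Finset.sum_congr rfl fun s _ => Finset.sum_congr rfl fun z _ => by ring

lemma Kern_exists (w F : ℤ → ℝ) (hw : ∀ x, 0 ≤ w x) (Λ : ℝ) (hΛ : 0 ≤ Λ)
    (h : ∀ x, Λ * F x ≤ ∑ s ∈ S1, w (x + s) * F (x + s)) (k : ℕ) :
    ∃ z, Λ ^ k * F 0 / (2 * k + 1) ≤ Kern S1 w k 0 z * F z := by
  by_contra! hc
  have h1 := Kern_sum_ge w F hw Λ hΛ h k k 0 (by omega) (by omega)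
  have h2 : ∑ z ∈ Finset.Icc (-(k : ℤ)) k, Kern S1 w k 0 z * F z
      < ∑ z ∈ Finset.Icc (-(k : ℤ)) k, Λ ^ k * F 0 / (2 * k + 1) :=
    Finset.sum_lt_sum_of_nonempty ⟨0, by simp⟩ fun z _ => hc z
  rw [Finset.sum_const, Int.card_Icc, nsmul_eq_mul] at h2
  have h3 : ((((k : ℤ) + 1 - -(k : ℤ)).toNat : ℕ) : ℝ) = 2 * k + 1 := by
    rw [show ((k : ℤ) + 1 - -(k : ℤ)) = ((2 * k + 1 : ℕ) : ℤ) by push_cast; ring, Int.toNat_natCast]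
    push_cast; ring
  rw [h3, mul_div_cancel₀ _ (by positivity)] at h2
  linarith

noncomputable def mu (x : ℝ) : ℝ := √x + (√x)⁻¹

lemma NN_neg (k : ℕ) (z : ℤ) : NN k 0 (-z) = NN k 0 z := by
  rw [NN_symm, ← NN_trans k (-z) 0 z]; simp

lemma NN_natAbs (k : ℕ) (z : ℤ) : NN k 0 (z.natAbs : ℤ) = NN k 0 z := by
  rcases Int.natAbs_eq z with h | h
  · rw [← h]
  · conv_rhs => rw [h, NN_neg]

lemma NN_block (y : ℝ) (hy : 0 < y) (k : ℕ) :
    ∃ b : ℕ, (mu (max 1 y) ^ k / (2 * k + 1)) ^ 2 ≤ √y ^ b * NN (2 * k) 0 b := by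
  set t := √(max 1 y) with ht
  have ht1 : 1 ≤ t := by rw [ht]; exact Real.one_le_sqrt.2 (le_max_left _ _)
  have ht0 : 0 < t := by linarith
  obtain ⟨z, hz⟩ := Kern_exists (fun _ => 1) (fun z => t ^ z) (by simp) (t + t⁻¹) (by positivity)
    (by
      intro x
      rw [sum_S1, zpow_add₀ ht0.ne', zpow_add₀ ht0.ne', zpow_neg, zpow_one]
      apply le_of_eq; ring) k
  change _ ≤ NN k 0 z * t ^ z at hz
  rw [zpow_zero, mul_one] at hz
  set d := z.natAbs with hd
  have hd1 : (t + t⁻¹) ^ k / (2 * k + 1) ≤ t ^ d * NN k 0 d := by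
    rw [hd, NN_natAbs, mul_comm (t ^ _)]
    refine hz.trans (mul_le_mul_of_nonneg_left ?_ (NN_nonneg _ _ _))
    rw [← zpow_natCast]
    exact zpow_le_zpow_right₀ ht1 (by omega)
  have hsq : (mu (max 1 y) ^ k / (2 * k + 1)) ^ 2 ≤ (t ^ d * NN k 0 d) ^ 2 := by
    have : 0 ≤ (t + t⁻¹) ^ k / (2 * k + 1) := by positivity
    exact pow_le_pow_left₀ this hd1 2
  rcases le_total 1 y with h | h
  · refine ⟨2 * d, hsq.trans ?_⟩
    have e : t = √y := by rw [ht, max_eq_right h]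
    have h1 := Kern_chain S1 (fun _ => (1 : ℝ)) (by simp) k k 0 (d : ℤ) ((2 * d : ℕ) : ℤ)
    change NN k 0 d * NN k d ((2 * d : ℕ) : ℤ) ≤ NN (k + k) 0 ((2 * d : ℕ) : ℤ) at h1
    have h2 : NN k d ((2 * d : ℕ) : ℤ) = NN k 0 d := by
      rw [← NN_trans k 0 d d]; push_cast; rw [zero_add, two_mul]
    rw [h2, ← two_mul] at h1
    rw [← e, mul_pow, ← pow_mul, mul_comm d 2]
    refine mul_le_mul_of_nonneg_left ?_ (by positivity)
    rwa [sq]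
  · refine ⟨0, hsq.trans ?_⟩
    have e : t = 1 := by rw [ht, max_eq_left h, Real.sqrt_one]
    have h1 := Kern_chain S1 (fun _ => (1 : ℝ)) (by simp) k k 0 (d : ℤ) 0
    change NN k 0 d * NN k d 0 ≤ NN (k + k) 0 0 at h1
    rw [NN_symm k d 0, ← two_mul] at h1
    rw [e]
    simp only [one_pow, one_mul, pow_zero, Nat.cast_zero]
    rwa [sq]

lemma DD_block (a : ℝ) (ha : 2 < a) (k : ℕ) :
    (mu (a - 1) ^ k / (a * (2 * k + 1))) ^ 2 ≤ DD a (2 * k) 0 0 := by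
  set r := √(a - 1) with hr
  have ha0 : 0 < a := by linarith
  have hr1 : 1 ≤ r := by rw [hr]; exact Real.one_le_sqrt.2 (by linarith)
  have hr0 : 0 < r := by linarith
  have hra : a = r ^ 2 + 1 := by rw [hr, Real.sq_sqrt (by linarith)]; ring
  set F : ℤ → ℝ := fun z => if 0 ≤ z then (if z = 0 then a⁻¹ else r ^ (-z)) else 0 with hF
  have hwF : ∀ z, wD a z * F z = if 0 ≤ z then r ^ (-z) else 0 := by
    intro z
    simp only [wD, hF]
    split_ifs with h1 h2
    · rw [h2]; simp [ha0.ne']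
    · simp
    · simp
  obtain ⟨z, hz⟩ := Kern_exists (wD a) F (wD_nonneg a ha0) (r + r⁻¹) (by positivity)
    (by
      intro x
      rw [sum_S1, hwF, hwF]
      rcases lt_trichotomy x 0 with h | h | h
      · have : F x = 0 := by simp only [hF]; rw [if_neg (by omega)]
        rw [this, mul_zero]
        refine add_nonneg ?_ ?_ <;> split_ifs <;> positivity
      · subst h
        have : F 0 = a⁻¹ := by simp [hF]
        rw [this]; norm_num
        rw [hra]; apply le_of_eq; field_simp
      · have : F x = r ^ (-x) := by simp only [hF]; rw [if_pos (by omega), if_neg (by omega)]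
        rw [this, if_pos (by omega), if_pos (by omega)]
        rw [neg_add, neg_add, zpow_add₀ hr0.ne', zpow_add₀ hr0.ne']
        simp only [neg_neg, zpow_neg, zpow_one]
        apply le_of_eq; ring) k
  change _ ≤ DD a k 0 z * F z at hz
  have hF0 : F 0 = a⁻¹ := by simp [hF]
  rw [hF0] at hz
  have hpos : 0 < (r + r⁻¹) ^ k * a⁻¹ / (2 * k + 1) := by positivity
  have hDn : ∀ x z, 0 ≤ DD a k x z := fun x z => Kern_nonneg _ _ (wD_nonneg a ha0) _ _ _
  have hz0 : 0 ≤ z := by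
    by_contra hc
    have : F z = 0 := by simp only [hF]; rw [if_neg hc]
    rw [this, mul_zero] at hz; linarith
  have hF1 : F z ≤ 1 := by
    simp only [hF]; rw [if_pos hz0]
    split_ifs
    · exact inv_le_one_of_one_le₀ (by linarith)
    · exact zpow_le_one_of_nonpos₀ hr1 (by omega)
  have h1 : (r + r⁻¹) ^ k * a⁻¹ / (2 * k + 1) ≤ DD a k 0 z :=
    hz.trans (mul_le_of_le_one_right (hDn _ _) hF1)
  have h2 : DD a k 0 z ≤ DD a k z 0 := by
    have := Kern_rev S1 S1_neg (wD a) k 0 z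
    change wD a 0 * DD a k 0 z = wD a z * DD a k z 0 at this
    have w0 : wD a 0 = a := by simp [wD]
    have wz : wD a z ≤ a := by unfold wD; split_ifs <;> linarith
    rw [w0] at this
    have h3 := mul_le_mul_of_nonneg_right wz (hDn z 0)
    rw [← this] at h3
    exact le_of_mul_le_mul_left h3 ha0
  have h3 := Kern_chain S1 (wD a) (wD_nonneg a ha0) k k 0 z 0
  change DD a k 0 z * DD a k z 0 ≤ DD a (k + k) 0 0 at h3
  rw [two_mul k]
  refine le_trans ?_ h3
  rw [sq]
  have e : mu (a - 1) ^ k / (a * (2 * k + 1)) = (r + r⁻¹) ^ k * a⁻¹ / (2 * k + 1) := by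
    change (r + r⁻¹) ^ k / _ = _
    field_simp
  rw [e]
  exact mul_le_mul h1 (h1.trans h2) hpos.le (hDn _ _)

/-! ### The partition function as a transfer sum -/

noncomputable def phi (n : ℕ) (a y : ℝ) (i : ℕ) (x : ℤ × ℤ) : ℝ :=
  if (0 ≤ x.1 ∧ 0 ≤ x.2 ∧ (0 < i → i < n → x.1 < x.2) ∧ (i = n → x.1 = x.2) ∧ (i = n / 2 → x.1 = 0))
  then (if x.1 = 0 then a else 1) * (if i = n / 2 then y ^ x.2 else 1) else 0

lemma phi_nonneg (n : ℕ) (a y : ℝ) (ha : 0 < a) (hy : 0 < y) (i : ℕ) (x : ℤ × ℤ) :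
    0 ≤ phi n a y i x := by
  unfold phi; split_ifs <;> positivity

lemma hgt_zero {n : ℕ} (c : ℤ) (s : Fin n → Bool) : hgt c s 0 = c := by simp [hgt]

lemma hgt_cons {n : ℕ} (c : ℤ) (b : Bool) (s : Fin n → Bool) (j : ℕ) :
    hgt c (Fin.cons b s : Fin (n + 1) → Bool) (j + 1) = hgt (c + if b then 1 else -1) s j := by
  unfold hgt
  rw [Finset.sum_range_succ', add_assoc, add_comm (∑ k ∈ _, _)]
  congr 1
  congr 1
  refine Finset.sum_congr rfl fun i _ => ?_
  by_cases h : i < n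
  · rw [dif_pos h, dif_pos (by omega)]
    have : (⟨i + 1, by omega⟩ : Fin (n + 1)) = Fin.succ ⟨i, h⟩ := rfl
    rw [this, Fin.cons_succ]
  · rw [dif_neg h, dif_neg (by omega)]

lemma sum_cons {n : ℕ} (f : (Fin (n + 1) → Bool) → ℝ) :
    ∑ s, f s = ∑ s : Fin n → Bool, (f (Fin.cons true s) + f (Fin.cons false s)) := by
  rw [← (Fin.consEquiv (fun _ : Fin (n + 1) => Bool)).sum_comp, Fintype.sum_prod_type]
  simp only [Fintype.sum_bool, Fin.consEquiv, Equiv.coe_fn_mk]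
  rw [Finset.sum_add_distrib]

lemma path_sum (φ : ℕ → ℤ × ℤ → ℝ) (n i : ℕ) (c c' : ℤ) :
    ∑ sp : Fin n → Bool, ∑ sm : Fin n → Bool,
      ∏ j ∈ Finset.range n, φ (i + j + 1) (hgt c sm (j + 1), hgt c' sp (j + 1))
      = VV S2 φ n i (c, c') := by
  induction n generalizing i c c' with
  | zero => simp [VV]
  | succ n ih =>
    rw [VV, sum_S2, sum_cons]
    simp_rw [sum_cons, Finset.prod_range_succ', hgt_cons, hgt_zero]
    simp only [Prod.mk_add_mk, ← ih, if_true, Finset.sum_add_distrib, Finset.mul_sum, add_zero]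
    have e : ∀ k, i + (k + 1) + 1 = i + 1 + k + 1 := by intro k; omega
    simp only [e, mul_comm (φ (i + 1) _)]
    simp only [Bool.false_eq_true, if_false]
    ring

lemma PC_eq (n : ℕ) (a y : ℝ) :
    PC n a y = ∑ c : Fin (n + 1), phi n a y 0 (((c : ℕ) : ℤ), ((c : ℕ) : ℤ)) *
      VV S2 (phi n a y) n 0 (((c : ℕ) : ℤ), ((c : ℕ) : ℤ)) := by
  unfold PC
  rw [Finset.sum_filter, Fintype.sum_prod_type]
  refine Finset.sum_congr rfl fun c _ => ?_
  rw [← path_sum, Fintype.sum_prod_type, Finset.mul_sum]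
  refine Finset.sum_congr rfl fun sp _ => ?_
  rw [Finset.mul_sum]
  refine Finset.sum_congr rfl fun sm _ => ?_
  generalize ((c : ℕ) : ℤ) = c
  simp only
  have e : phi n a y 0 (c, c) * ∏ j ∈ Finset.range n,
      phi n a y (0 + j + 1) (hgt c sm (j + 1), hgt c sp (j + 1))
      = ∏ j ∈ Finset.range (n + 1), phi n a y j (hgt c sm j, hgt c sp j) := by
    rw [Finset.prod_range_succ', hgt_zero, hgt_zero, mul_comm]
    simp only [zero_add]
  rw [e]
  unfold phi
  rw [Finset.prod_ite_zero]
  have hiff : (IsStaircase c sp sm ∧ hgt c sm (n / 2) = 0) ↔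
      ∀ i ∈ Finset.range (n + 1), 0 ≤ hgt c sm i ∧ 0 ≤ hgt c sp i ∧
        (0 < i → i < n → hgt c sm i < hgt c sp i) ∧ (i = n → hgt c sm i = hgt c sp i) ∧
        (i = n / 2 → hgt c sm i = 0) := by
    constructor
    · rintro ⟨⟨h1, h2, h3, h4, -⟩, h5⟩ i hi
      rw [Finset.mem_range] at hi
      refine ⟨h4 i (by omega), h3 i (by omega), h2 i, ?_, ?_⟩
      · rintro rfl; exact h1.symm
      · rintro rfl; exact h5
    · intro h
      have hm : n / 2 ≤ n := Nat.div_le_self _ _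
      have h5 : hgt c sm (n / 2) = 0 := (h (n / 2) (by rw [Finset.mem_range]; omega)).2.2.2.2 rfl
      refine ⟨⟨((h n (by simp)).2.2.2.1 rfl).symm, fun i h0 h1 => ?_, fun i hi => ?_, fun i hi => ?_,
        n / 2, hm, Or.inr h5⟩, h5⟩
      · exact (h i (by rw [Finset.mem_range]; omega)).2.2.1 h0 h1
      · exact (h i (by rw [Finset.mem_range]; omega)).2.1
      · exact (h i (by rw [Finset.mem_range]; omega)).1
  by_cases hc : IsStaircase c sp sm ∧ hgt c sm (n / 2) = 0
  · rw [if_pos hc, if_pos (hiff.1 hc), Finset.prod_mul_distrib]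
    congr 1
    · rw [Finset.prod_ite, Finset.prod_const, Finset.prod_const_one, mul_one, visits]
    · rw [Finset.prod_ite_eq' (Finset.range (n + 1)) (n / 2) (fun i => y ^ hgt c sp i), if_pos]
      rw [Finset.mem_range]; omega
  · rw [if_neg hc, if_neg (fun h => hc (hiff.2 h))]

/-! ### Lower bound -/

lemma wP_open (a : ℝ) (d : ℤ) (s : ℤ × ℤ) (hs : s ∈ S2) (h : s ≠ (-1, 1)) :
    wP a ((d, d) + s) = 0 := by
  obtain ⟨s1, s2⟩ := s
  simp only [S2, S1, Finset.mem_product, Finset.mem_insert, Finset.mem_singleton] at hs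
  simp only [ne_eq, Prod.mk.injEq] at h
  rw [wP, if_neg]
  simp only [Prod.mk_add_mk]
  omega

lemma mem_S2_open : ((-1, 1) : ℤ × ℤ) ∈ S2 := by decide
lemma mem_S2_down : ((-1, -1) : ℤ × ℤ) ∈ S2 := by decide

lemma KK_nonneg (a : ℝ) (ha : 0 < a) (k : ℕ) (x z : ℤ × ℤ) : 0 ≤ KK a k x z :=
  Kern_nonneg _ _ (wP_nonneg a ha) _ _ _

lemma KK_close (a : ℝ) (k : ℕ) (d h : ℤ) (hh : 0 < h) :
    KK a (k + 1) (d, d) (0, h) = a * KK a k (0, h) (d - 1, d + 1) := by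
  have e : KK a (k + 1) (d, d) (0, h)
      = wP a (d - 1, d + 1) * KK a k (d - 1, d + 1) (0, h) := by
    unfold KK
    rw [Kern, Finset.sum_eq_single ((-1, 1) : ℤ × ℤ)]
    · simp only [Prod.mk_add_mk, ← sub_eq_add_neg]
    · intro s hs hne
      rw [wP_open a d s hs hne, zero_mul]
    · intro hn; exact absurd mem_S2_open hn
  rw [e]
  have := Kern_rev S2 S2_neg (wP a) k (d - 1, d + 1) (0, h)
  change _ * KK a k _ _ = _ * KK a k _ _ at this
  rw [this]
  congr 1
  simp [wP, wD, hh]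

lemma PC_ge (n : ℕ) (a y : ℝ) (ha : 0 < a) (hy : 0 < y) (hn : 4 ≤ n) (c d : ℕ) (h : ℤ)
    (hc : 1 ≤ c) (hd : 1 ≤ d) (hcn : c ≤ n) (hh : 0 < h) :
    y ^ h / a * KK a (n / 2) (c, c) (0, h) * KK a (n - n / 2) (d, d) (0, h) ≤ PC n a y := by
  have hφ := phi_nonneg n a y ha hy
  have hw := wP_nonneg a ha
  have hle : ∀ i x, 0 < i → i < n → i ≠ n / 2 → wP a x ≤ phi n a y i x := by
    intro i x h0 h1 h2
    unfold wP
    split_ifs with hx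
    · unfold wD
      split_ifs with h3 h4
      · rw [phi, if_pos ⟨h3, by omega, fun _ _ => hx, fun h => by omega, fun h => absurd h h2⟩]
        simp [h4, h2]
      · rw [phi, if_pos ⟨h3, by omega, fun _ _ => hx, fun h => by omega, fun h => absurd h h2⟩]
        simp [h4, h2]
      · exact hφ i x
    · exact hφ i x
  obtain ⟨k, hk⟩ : ∃ k, n / 2 = k + 1 := ⟨n / 2 - 1, by omega⟩
  obtain ⟨k', hk'⟩ : ∃ k', n - n / 2 = k' + 1 + 1 := ⟨n - n / 2 - 2, by omega⟩
  have hnk : n = k + 1 + (k' + 1 + 1) := by omega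
  have A1 := VV_chain S2 (wP a) (phi n a y) hw hφ (y ^ h) (0, h) k (k' + 1 + 1) 0 (c, c)
    (fun i' x p q => hle i' x p (by omega) (by omega))
    (by
      rw [phi, if_pos ⟨le_rfl, hh.le, fun _ _ => hh, fun h => by omega, fun _ => rfl⟩]
      simp only [wP, wD, hh, if_true, le_refl]
      rw [if_pos (by omega), mul_comm])
  have A2 := VV_chain S2 (wP a) (phi n a y) hw hφ 1 ((d : ℤ) - 1, (d : ℤ) + 1) k' 1 (k + 1) (0, h)
    (fun i' x p q => hle i' x (by omega) (by omega) (by omega))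
    (by rw [one_mul]; exact hle _ _ (by omega) (by omega) (by omega))
  have A3 : 1 ≤ VV S2 (phi n a y) 1 (k + 1 + (k' + 1)) ((d : ℤ) - 1, (d : ℤ) + 1) := by
    rw [VV]
    refine le_trans ?_ (Finset.single_le_sum (fun s _ => mul_nonneg (hφ _ _)
      (VV_nonneg _ _ hφ _ _ _)) (show ((1, -1) : ℤ × ℤ) ∈ S2 by decide))
    simp only [VV, mul_one, Prod.mk_add_mk]
    rw [phi, if_pos ⟨by simp, by simp, fun _ h => by omega, fun _ => by simp,
      fun h => by omega⟩]
    rw [if_neg (by simp; omega), if_neg (by omega), mul_one]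
  have hK1 := KK_nonneg a ha (k + 1) (c, c) (0, h)
  have hK2 := KK_nonneg a ha (k' + 1) (0, h) ((d : ℤ) - 1, (d : ℤ) + 1)
  have hyh : 0 < y ^ h := by positivity
  rw [PC_eq]
  refine le_trans ?_ (Finset.single_le_sum (fun (c : Fin (n + 1)) _ => mul_nonneg (hφ 0
    (((c : ℕ) : ℤ), ((c : ℕ) : ℤ))) (VV_nonneg S2 _ hφ n 0 (((c : ℕ) : ℤ), ((c : ℕ) : ℤ))))
    (Finset.mem_univ (⟨c, by omega⟩ : Fin (n + 1))))
  have e0 : phi n a y 0 ((c : ℤ), (c : ℤ)) = 1 := by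
    rw [phi, if_pos ⟨by simp, by simp, fun h => by omega, fun _ => rfl, fun h => by omega⟩]
    rw [if_neg (by simp; omega), if_neg (by omega), mul_one]
  simp only
  rw [e0, one_mul, hk', hk, KK_close a (k' + 1) (d : ℤ) h hh]
  have en : VV S2 (phi n a y) (k + 1 + (k' + 1 + 1)) 0 ((c : ℤ), (c : ℤ))
      = VV S2 (phi n a y) n 0 ((c : ℤ), (c : ℤ)) := by rw [← hnk]
  rw [← en]
  rw [zero_add] at A1
  change y ^ h * KK a (k + 1) (c, c) (0, h) * _ ≤ _ at A1
  change 1 * KK a (k' + 1) (0, h) _ * _ ≤ _ at A2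
  refine le_trans ?_ A1
  calc y ^ h / a * KK a (k + 1) (c, c) (0, h) * (a * KK a (k' + 1) (0, h) ((d : ℤ) - 1, (d : ℤ) + 1))
      = y ^ h * KK a (k + 1) (c, c) (0, h) *
        (1 * KK a (k' + 1) (0, h) ((d : ℤ) - 1, (d : ℤ) + 1) * 1) := by field_simp
    _ ≤ y ^ h * KK a (k + 1) (c, c) (0, h) * VV S2 (phi n a y) (k' + 1 + 1) (k + 1) (0, h) := by
      refine mul_le_mul_of_nonneg_left (le_trans ?_ A2) (by positivity)
      exact mul_le_mul_of_nonneg_left A3 (by positivity)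

lemma KK_support (a : ℝ) (k : ℕ) (l u l' u' : ℤ) (h : KK a k (l, u) (l', u') ≠ 0) :
    l - l' ≤ k := by
  induction k generalizing l u with
  | zero =>
    simp only [KK, Kern, Prod.mk.injEq, ne_eq, ite_eq_right_iff, not_forall] at h
    obtain ⟨⟨h1, -⟩, -⟩ := h
    simp [h1]
  | succ k ih =>
    unfold KK at h ih
    rw [Kern] at h
    obtain ⟨⟨s1, s2⟩, hs, h1⟩ := Finset.exists_ne_zero_of_sum_ne_zero h
    have h2 := ih (l + s1) (u + s2) (right_ne_zero_of_mul h1)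
    simp only [S2, S1, Finset.mem_product, Finset.mem_insert, Finset.mem_singleton] at hs
    push_cast
    omega

lemma KK_chain (a : ℝ) (ha : 0 < a) (A B : ℝ) (i j : ℕ) (x y z : ℤ × ℤ) (hB : 0 ≤ B)
    (h1 : A ≤ KK a i x y) (h2 : B ≤ KK a j y z) : A * B ≤ KK a (i + j) x z :=
  (mul_le_mul h1 h2 hB (KK_nonneg a ha _ _ _)).trans (Kern_chain S2 _ (wP_nonneg a ha) _ _ _ _ _)

lemma wP_ge (a : ℝ) (x : ℤ × ℤ) (h0 : 0 ≤ x.1) (h1 : x.1 < x.2) : min 1 a ≤ wP a x := by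
  rw [wP, if_pos h1, wD, if_pos h0]
  split_ifs
  · exact min_le_right _ _
  · exact min_le_left _ _

lemma KK_open (a : ℝ) (ha : 0 < a) (j : ℕ) (l u l' u' : ℤ) (h0 : l' = l - j) (h1 : u' = u + j)
    (h2 : 0 ≤ l') (h3 : l ≤ u) :
    (min 1 a) ^ j ≤ KK a j (l, u) (l', u') := by
  refine Kern_straight S2 (wP a) (wP_nonneg a ha) (-1, 1) mem_S2_open _ (by positivity) j _ _ ?_ ?_
  · ext <;> simp [h0, h1]; ring
  · intro i hi hij
    apply wP_ge <;> simp <;> omega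

lemma KK_down (a : ℝ) (ha : 0 < a) (j : ℕ) (l u l' u' : ℤ) (h0 : l' = l - j) (h1 : u' = u - j)
    (h2 : 0 ≤ l') (h3 : l < u) :
    (min 1 a) ^ j ≤ KK a j (l, u) (l', u') := by
  refine Kern_straight S2 (wP a) (wP_nonneg a ha) (-1, -1) mem_S2_down _ (by positivity) j _ _ ?_ ?_
  · ext <;> simp [h0, h1] <;> ring
  · intro i hi hij
    apply wP_ge <;> simp <;> omega

lemma mu_pos (x : ℝ) (hx : 0 < x) : 0 < mu x := by
  have := Real.sqrt_pos.2 hx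
  unfold mu; positivity

lemma half (a y : ℝ) (ha : 0 < a) (hy : 0 < y) (k : ℕ) :
    ∃ (s0 : ℕ) (ε R U : ℝ) (h : ℕ → ℤ), 0 < ε ∧ 0 < R ∧ 0 < U ∧
      (mu (max 1 y) * mu (max (max 1 y) (a - 1))) ^ (4 * k) / ((1 + a) ^ 4 * (2 * k + 1) ^ 8)
        ≤ U * R ^ 2 ∧
      ∀ q, 0 < h q ∧ ε * U ^ q ≤ y ^ (h q) ∧ ∀ ρ ≤ 2 * k, ∃ c : ℕ, 1 ≤ c ∧
        ε * R ^ q ≤ KK a (s0 + ρ + q * (2 * k)) ((c : ℤ), (c : ℤ)) (0, h q) := by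
  obtain ⟨b, hb⟩ := NN_block y hy k
  set Y := max 1 y with hY
  have hY1 : 1 ≤ Y := le_max_left _ _
  have hmu : 0 < mu Y := mu_pos Y (by linarith)
  set N := NN (2 * k) 0 b with hN
  set L := 2 * k with hL
  set ω := min 1 a with hω
  have hω0 : 0 < ω := by positivity
  have hω1 : ω ≤ 1 := min_le_left _ _
  have hsy : 0 < √y := Real.sqrt_pos.2 hy
  have hbase : 0 < mu Y ^ k / (2 * k + 1) := by positivity
  have hNpos : 0 < N := by
    have : 0 < √y ^ b * N := lt_of_lt_of_le (by positivity) hb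
    exact pos_of_mul_pos_right this (by positivity)
  have hysq : y = √y ^ 2 := (Real.sq_sqrt hy.le).symm
  rcases le_or_gt (a - 1) Y with hA | hB
  · -- both paths drift
    rw [max_eq_left hA]
    refine ⟨2 * (L + 1), min (y ^ (4 * L + 4)) (ω ^ (3 * L + 2)), N * N, y ^ (2 * b),
      fun q => 4 * L + 4 + 2 * q * b, by positivity, by positivity, by positivity, ?_, ?_⟩
    · have h1 : y ^ (2 * b) * (N * N) ^ 2 = (√y ^ b * N) ^ 4 := by
        conv_lhs => rw [hysq]
        ring
      rw [h1]
      calc (mu Y * mu Y) ^ (4 * k) / ((1 + a) ^ 4 * (2 * k + 1) ^ 8)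
          ≤ (mu Y * mu Y) ^ (4 * k) / (1 * (2 * k + 1) ^ 8) := by
            gcongr
            exact one_le_pow₀ (by linarith)
        _ = ((mu Y ^ k / (2 * k + 1)) ^ 2) ^ 4 := by
            rw [one_mul, ← pow_mul, div_pow, ← pow_mul, ← sq, ← pow_mul]; congr 2; ring
        _ ≤ _ := pow_le_pow_left₀ (by positivity) hb 4
    · intro q
      refine ⟨by positivity, ?_, ?_⟩
      · have : y ^ ((4 * L + 4 + 2 * q * b : ℤ)) = y ^ (4 * L + 4) * (y ^ (2 * b)) ^ q := by
          rw [← pow_mul, ← pow_add, ← zpow_natCast]; congr 1; push_cast; ring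
        rw [this]
        exact mul_le_mul_of_nonneg_right (min_le_left _ _) (by positivity)
      · intro ρ hρ
        refine ⟨2 * L + 2 + ρ + q * b, by omega, ?_⟩
        set c : ℤ := ((2 * L + 2 + ρ + q * b : ℕ) : ℤ) with hc
        have hc' : c = 2 * L + 2 + ρ + q * b := by rw [hc]; push_cast; ring
        have hqb : (0 : ℤ) ≤ q * b := by positivity
        have k1 := KK_open a ha (L + 1) c c (c - (L + 1)) (c + (L + 1)) (by push_cast; ring)
          (by push_cast; ring) (by omega) le_rfl
        have k2 := KK_down a ha ρ (c - (L + 1)) (c + (L + 1)) (L + 1 + q * b) (3 * L + 3 + q * b)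
          (by omega) (by omega) (by omega) (by omega)
        have k3 := Kern_pow S2 (wP a) (wP_nonneg a ha) L (N * N) (by positivity)
          (fun i => ((L : ℤ) + 1 + q * b - i * b, (3 * L + 3 + q * b + i * b : ℤ))) q
          (by
            intro i hi
            change _ ≤ KK a L _ _
            have hib : ((i : ℤ) + 1) * b ≤ q * b :=
              mul_le_mul_of_nonneg_right (by omega) (by positivity)
            have hib0 : 0 ≤ (i : ℤ) * b := by positivity
            have hb0 : 0 ≤ (b : ℤ) := by positivity
            rw [add_mul, one_mul] at hib
            rw [KK_prod a L _ _ _ _ (by omega), DD_eq_NN a L _ _ (by omega)]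
            have e1 : NN L ((L : ℤ) + 1 + q * b - i * b) ((L : ℤ) + 1 + q * b - ((i + 1 : ℕ) : ℤ) * b)
                = N := by
              rw [NN_symm, hN, ← NN_trans L 0 b ((L : ℤ) + 1 + q * b - ((i + 1 : ℕ) : ℤ) * b)]
              congr 1
              · ring
              · push_cast; ring
            have e2 : NN L (3 * L + 3 + q * b + i * b : ℤ) (3 * L + 3 + q * b + ((i + 1 : ℕ) : ℤ) * b)
                = N := by
              rw [hN, ← NN_trans L 0 b (3 * L + 3 + q * b + i * b : ℤ)]
              congr 1
              · ring
              · push_cast; ring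
            rw [e1, e2])
        change _ ≤ KK a _ _ _ at k3
        have k4 := KK_open a ha (L + 1) (L + 1) (3 * L + 3 + q * b + q * b) 0
          (4 * L + 4 + 2 * q * b) (by push_cast; ring) (by push_cast; ring) le_rfl (by omega)
        simp only [Nat.cast_zero, zero_mul, sub_zero, add_zero, add_sub_cancel_right] at k3
        have k12 := KK_chain a ha _ _ _ _ _ _ _ (by positivity) k1 k2
        have k123 := KK_chain a ha _ _ _ _ _ _ _ (by positivity) k12 k3
        have k1234 := KK_chain a ha _ _ _ _ _ _ _ (by positivity) k123 k4
        have en : L + 1 + ρ + q * L + (L + 1) = 2 * (L + 1) + ρ + q * L := by ring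
        rw [en] at k1234
        refine le_trans ?_ k1234
        have hp : ω ^ (3 * L + 2) ≤ ω ^ (L + 1) * ω ^ ρ * ω ^ (L + 1) := by
          rw [← pow_add, ← pow_add]
          exact pow_le_pow_of_le_one hω0.le hω1 (by omega)
        calc min (y ^ (4 * L + 4)) (ω ^ (3 * L + 2)) * (N * N) ^ q
            ≤ (ω ^ (L + 1) * ω ^ ρ * ω ^ (L + 1)) * (N * N) ^ q :=
              mul_le_mul_of_nonneg_right ((min_le_right _ _).trans hp) (by positivity)
          _ = _ := by ring
  · -- the lower path is pinned
    rw [max_eq_right hB.le]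
    have ha2 : 2 < a := by linarith
    have hDb := DD_block a ha2 k
    rw [← hL] at hDb
    set D := DD a L 0 0 with hD
    have hmu2 : 0 < mu (a - 1) := mu_pos _ (by linarith)
    have hDpos : 0 < D := lt_of_lt_of_le (by positivity) hDb
    refine ⟨L + 1, min (y ^ (2 * L + 2)) (ω ^ (2 * L + 1)), D * N, y ^ b,
      fun q => 2 * L + 2 + q * b, by positivity, by positivity, by positivity, ?_, ?_⟩
    · have h1 : y ^ b * (D * N) ^ 2 = (√y ^ b * N) ^ 2 * D ^ 2 := by
        conv_lhs => rw [hysq]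
        ring
      rw [h1]
      calc (mu Y * mu (a - 1)) ^ (4 * k) / ((1 + a) ^ 4 * (2 * k + 1) ^ 8)
          ≤ (mu Y * mu (a - 1)) ^ (4 * k) / (a ^ 4 * (2 * k + 1) ^ 8) := by
            gcongr
            linarith
        _ = ((mu Y ^ k / (2 * k + 1)) ^ 2) ^ 2 * ((mu (a - 1) ^ k / (a * (2 * k + 1))) ^ 2) ^ 2 := by
            rw [mul_pow, ← pow_mul, div_pow, ← pow_mul, ← pow_mul, div_pow, ← pow_mul, mul_pow,
              mul_comm 4 k, div_mul_div_comm]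
            congr 1
            ring
        _ ≤ _ := mul_le_mul (pow_le_pow_left₀ (by positivity) hb 2)
            (pow_le_pow_left₀ (by positivity) hDb 2) (by positivity) (by positivity)
    · intro q
      refine ⟨by positivity, ?_, ?_⟩
      · have : y ^ ((2 * L + 2 + q * b : ℤ)) = y ^ (2 * L + 2) * (y ^ b) ^ q := by
          rw [← pow_mul, ← pow_add, ← zpow_natCast]; congr 1; push_cast; ring
        rw [this]
        exact mul_le_mul_of_nonneg_right (min_le_left _ _) (by positivity)
      · intro ρ hρ
        refine ⟨L + 1 + ρ, by omega, ?_⟩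
        set c : ℤ := ((L + 1 + ρ : ℕ) : ℤ) with hc
        have hc' : c = L + 1 + ρ := by rw [hc]; push_cast; ring
        have k1 := KK_open a ha (L + 1) c c (c - (L + 1)) (c + (L + 1)) (by push_cast; ring)
          (by push_cast; ring) (by omega) le_rfl
        have k2 := KK_down a ha ρ (c - (L + 1)) (c + (L + 1)) 0 (2 * L + 2)
          (by omega) (by omega) (by omega) (by omega)
        have k3 := Kern_pow S2 (wP a) (wP_nonneg a ha) L (D * N) (by positivity)
          (fun i => ((0 : ℤ), (2 * L + 2 + i * b : ℤ))) q
          (by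
            intro i hi
            change _ ≤ KK a L _ _
            have hib0 : 0 ≤ (i : ℤ) * b := by positivity
            rw [KK_prod a L _ _ _ _ (by omega)]
            have e2 : NN L (2 * L + 2 + i * b : ℤ) (2 * L + 2 + ((i + 1 : ℕ) : ℤ) * b)
                = N := by
              rw [hN, ← NN_trans L 0 b (2 * L + 2 + i * b : ℤ)]
              congr 1
              · ring
              · push_cast; ring
            rw [e2])
        change _ ≤ KK a _ _ _ at k3
        simp only [Nat.cast_zero, zero_mul, add_zero] at k3
        have k12 := KK_chain a ha _ _ _ _ _ _ _ (by positivity) k1 k2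
        have k123 := KK_chain a ha _ _ _ _ _ _ _ (by positivity) k12 k3
        refine le_trans ?_ k123
        have hp : ω ^ (2 * L + 1) ≤ ω ^ (L + 1) * ω ^ ρ := by
          rw [← pow_add]
          exact pow_le_pow_of_le_one hω0.le hω1 (by omega)
        exact mul_le_mul_of_nonneg_right ((min_le_right _ _).trans hp) (by positivity)

lemma PC_lower (a y : ℝ) (ha : 0 < a) (hy : 0 < y) (k : ℕ) (hk : 0 < k) :
    ∃ (s0 : ℕ) (ε X : ℝ), 0 < ε ∧ 0 < X ∧
      (mu (max 1 y) * mu (max (max 1 y) (a - 1))) ^ (4 * k) / ((1 + a) ^ 4 * (2 * k + 1) ^ 8) ≤ X ∧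
      ∀ n, 4 ≤ n → s0 ≤ n / 2 → ε * X ^ ((n / 2 - s0) / (2 * k)) ≤ PC n a y := by
  obtain ⟨s0, ε, R, U, h, hε, hR, hU, hX, H⟩ := half a y ha hy k
  refine ⟨s0, ε ^ 3 / a, U * R ^ 2, by positivity, by positivity, hX, ?_⟩
  intro n hn hs
  set q := (n / 2 - s0) / (2 * k) with hq
  obtain ⟨hh, hyq, hK⟩ := H q
  have hdm := Nat.div_add_mod (n / 2 - s0) (2 * k)
  have hml := Nat.mod_lt (n / 2 - s0) (show 0 < 2 * k by omega)
  set ρ := (n / 2 - s0) % (2 * k) with hρ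
  rw [← hq, mul_comm] at hdm
  obtain ⟨c, hc, hcK⟩ := hK ρ (by omega)
  obtain ⟨d, hd, hdK⟩ := hK (ρ + (n - n / 2 - n / 2)) (by omega)
  rw [show s0 + ρ + q * (2 * k) = n / 2 by omega] at hcK
  rw [show s0 + (ρ + (n - n / 2 - n / 2)) + q * (2 * k) = n - n / 2 by omega] at hdK
  have hpos : 0 < ε * R ^ q := by positivity
  have hcn : c ≤ n := by
    have := KK_support a _ _ _ _ _ (hpos.trans_le hcK).ne'
    omega
  refine le_trans ?_ (PC_ge n a y ha hy hn c d (h q) hc hd hcn hh)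
  calc ε ^ 3 / a * (U * R ^ 2) ^ q = (ε * U ^ q) / a * (ε * R ^ q) * (ε * R ^ q) := by ring
    _ ≤ _ := by
      have hyh : 0 < y ^ h q := by positivity
      refine mul_le_mul (mul_le_mul ?_ hcK hpos.le (by positivity)) hdK hpos.le ?_
      · gcongr
      · exact mul_nonneg (by positivity) (KK_nonneg a ha _ _ _)

/-! ### Upper bound -/

noncomputable def sg (s : ℝ) (l : ℤ) : ℝ := if 0 ≤ l then s ^ (-l) else 0

noncomputable def gm (A B s : ℝ) (l : ℤ) : ℝ := if 0 ≤ l then A * (s ^ l + B * s ^ (-l)) else 0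

lemma sg_super (a s : ℝ) (hs : 0 < s) (has : a ≤ s ^ 2 + 1) (l : ℤ) (hl : 0 ≤ l) :
    (if l = 0 then a else 1) * (sg s (l + 1) + sg s (l + -1)) ≤ (s + s⁻¹) * sg s l := by
  unfold sg
  split_ifs with h1 h2 h3 h3 <;> try omega
  · subst h1
    simp only [zero_add, zpow_neg, zpow_one, neg_zero, zpow_zero, mul_one, add_zero]
    rw [← div_eq_mul_inv, div_le_iff₀ hs]
    field_simp; linarith
  · rw [neg_add, neg_add, zpow_add₀ hs.ne', zpow_add₀ hs.ne']
    simp only [neg_neg, zpow_neg, zpow_one]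
    apply le_of_eq; ring

lemma gm_super (a s A B : ℝ) (hs : 0 < s) (hA : 0 ≤ A)
    (hB : a * s ^ 2 ≤ B * (s ^ 2 + 1 - a)) (l : ℤ) (hl : 0 ≤ l) :
    (if l = 0 then a else 1) * (gm A B s (l + 1) + gm A B s (l + -1))
      ≤ (s + s⁻¹) * gm A B s l := by
  unfold gm
  split_ifs with h1 h2 h3 h3 <;> try omega
  · subst h1
    simp only [zero_add, zpow_neg, zpow_one, neg_zero, zpow_zero, mul_one, add_zero]
    have : a * (s + B * s⁻¹) ≤ (s + s⁻¹) * (1 + B) := by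
      have e1 : a * (s + B * s⁻¹) = (a * s ^ 2 + a * B) / s := by field_simp
      have e2 : (s + s⁻¹) * (1 + B) = ((s ^ 2 + 1) * (1 + B)) / s := by field_simp
      rw [e1, e2]
      gcongr
      nlinarith [sq_nonneg s]
    nlinarith
  · rw [neg_add, neg_add, zpow_add₀ hs.ne', zpow_add₀ hs.ne', zpow_add₀ hs.ne', zpow_add₀ hs.ne']
    simp only [neg_neg, zpow_neg, zpow_one]
    apply le_of_eq; ring

lemma PC_upper (a y s : ℝ) (ha : 0 < a) (hy : 0 < y) (hst : √(max 1 y) ≤ s) (has : a < s ^ 2 + 1) :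
    ∃ C : ℝ, 0 < C ∧ ∀ n : ℕ, 1 ≤ n →
      PC n a y ≤ C * (n + 1) * (mu (max 1 y) * (s + s⁻¹)) ^ n := by
  set t := √(max 1 y) with ht
  have ht1 : 1 ≤ t := by rw [ht]; exact Real.one_le_sqrt.2 (le_max_left _ _)
  have ht0 : 0 < t := by linarith
  have hs : 0 < s := by linarith
  have hyt : y ≤ t ^ 2 := by
    rw [ht, Real.sq_sqrt (by positivity)]; exact le_max_right _ _
  set A := 1 + a with hA
  set B := a * s ^ 2 / (s ^ 2 + 1 - a) with hB
  have hA0 : 0 < A := by positivity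
  have hB0 : 0 < B := div_pos (by positivity) (by linarith)
  have hB1 : a * s ^ 2 ≤ B * (s ^ 2 + 1 - a) := by
    rw [hB, div_mul_cancel₀ _ (by linarith)]
  set C := A * (1 + B) with hC
  have hC0 : 0 < C := by positivity
  refine ⟨C, hC0, ?_⟩
  intro n hn
  set G : ℕ → ℤ × ℤ → ℝ := fun i x =>
    if i ≤ n / 2 then C * t ^ x.2 * sg s x.1 else t ^ (-x.2) * gm A B s x.1 with hG
  have hsg0 : ∀ l, 0 ≤ sg s l := by intro l; unfold sg; split_ifs <;> positivity
  have hgm0 : ∀ l, 0 ≤ gm A B s l := by intro l; unfold gm; split_ifs <;> positivity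
  have hG0 : ∀ i x, 0 ≤ G i x := by
    intro i x; simp only [hG]
    have := hsg0 x.1
    have := hgm0 x.1
    split_ifs <;> positivity
  have hφ := phi_nonneg n a y ha hy
  have hmu : mu (max 1 y) = t + t⁻¹ := rfl
  rw [hmu]
  have key := VV_upper S2 (phi n a y) G hφ ((t + t⁻¹) * (s + s⁻¹)) n (by positivity)
    (by
      rintro ⟨l, u⟩
      unfold phi
      split_ifs with h1 h2 h3 h3 <;> try omega
      · simp only at h1 h2
        have hlu : l = u := h1.2.2.2.1 trivial
        subst hlu; subst h2
        simp only [hG, gm]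
        rw [if_neg (by omega)]
        simp
        nlinarith
      · simp only at h1 h2
        have hlu : l = u := h1.2.2.2.1 trivial
        subst hlu
        simp only [hG, gm]
        rw [if_neg (by omega), if_pos h1.1]
        have e : t ^ l ≤ s ^ l := by
          lift l to ℕ using h1.1
          simp only [zpow_natCast]
          exact pow_le_pow_left₀ ht0.le hst _
        have e2 : 0 < s ^ (-l) := by positivity
        have e3 : 0 < t ^ (-l) := by positivity
        calc (1 : ℝ) * 1 = t ^ (-l) * (1 * t ^ l) := by
              rw [one_mul, one_mul, ← zpow_add₀ ht0.ne']; simp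
          _ ≤ t ^ (-l) * (A * (s ^ l + B * s ^ (-l))) := by
              gcongr
              · linarith
              · have : 0 < B * s ^ (-l) := by positivity
                linarith
      · exact hG0 _ _)
    (by
      rintro i ⟨l, u⟩ hi
      by_cases hcond : (0 ≤ (l, u).1 ∧ 0 ≤ (l, u).2 ∧ (0 < i → i < n → (l, u).1 < (l, u).2) ∧
        (i = n → (l, u).1 = (l, u).2) ∧ (i = n / 2 → (l, u).1 = 0))
      swap
      · rw [phi, if_neg hcond, zero_mul]
        exact mul_nonneg (by positivity) (hG0 _ _)
      rw [phi, if_pos hcond]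
      simp only at hcond
      obtain ⟨hl, hu, -, -, hm⟩ := hcond
      rw [sum_S2]
      simp only [hG, Prod.mk_add_mk]
      have hS := sg_super a s hs has.le l hl
      have hg := gm_super a s A B hs hA0.le hB1 l hl
      have tu : t ^ (u + 1) + t ^ (u + -1) = (t + t⁻¹) * t ^ u := by
        rw [zpow_add₀ ht0.ne', zpow_add₀ ht0.ne', zpow_neg, zpow_one]; ring
      have tu' : t ^ (-(u + 1)) + t ^ (-(u + -1)) = (t + t⁻¹) * t ^ (-u) := by
        rw [neg_add, neg_add, zpow_add₀ ht0.ne', zpow_add₀ ht0.ne']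
        simp only [neg_neg, zpow_neg, zpow_one]; ring
      have pu : 0 < t ^ u := by positivity
      have pu' : 0 < t ^ (-u) := by positivity
      have pt : 0 < t + t⁻¹ := by positivity
      rcases lt_trichotomy i (n / 2) with h | h | h
      · rw [if_neg h.ne]
        simp only [if_pos (show i + 1 ≤ n / 2 by omega), if_pos h.le]
        calc _ = C * (t ^ (u + 1) + t ^ (u + -1)) *
              ((if l = 0 then a else 1) * (sg s (l + 1) + sg s (l + -1))) := by ring
          _ = C * ((t + t⁻¹) * t ^ u) *
              ((if l = 0 then a else 1) * (sg s (l + 1) + sg s (l + -1))) := by rw [tu]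
          _ ≤ C * ((t + t⁻¹) * t ^ u) * ((s + s⁻¹) * sg s l) :=
              mul_le_mul_of_nonneg_left hS (by positivity)
          _ = _ := by ring
      · have hl0 := hm h
        subst hl0
        rw [if_pos h]
        simp only [if_neg (show ¬ i + 1 ≤ n / 2 by omega), if_pos h.le]
        have hyu : y ^ u ≤ t ^ u * t ^ u := by
          lift u to ℕ using hu
          simp only [zpow_natCast]
          rw [← mul_pow, ← sq]
          exact pow_le_pow_left₀ hy.le hyt _
        have e0 : gm A B s 0 = C * sg s 0 := by simp [gm, sg, hC]
        have hsum : 0 ≤ (if (0 : ℤ) = 0 then a else 1) * (gm A B s (0 + 1) + gm A B s (0 + -1)) :=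
          mul_nonneg (by simp [ha.le]) (add_nonneg (hgm0 _) (hgm0 _))
        calc _ = y ^ u * (t ^ (-(u + 1)) + t ^ (-(u + -1))) *
              ((if (0 : ℤ) = 0 then a else 1) * (gm A B s (0 + 1) + gm A B s (0 + -1))) := by ring
          _ = y ^ u * ((t + t⁻¹) * t ^ (-u)) *
              ((if (0 : ℤ) = 0 then a else 1) * (gm A B s (0 + 1) + gm A B s (0 + -1))) := by rw [tu']
          _ ≤ (t ^ u * t ^ u) * ((t + t⁻¹) * t ^ (-u)) * ((s + s⁻¹) * gm A B s 0) := by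
              refine mul_le_mul ?_ hg hsum (by positivity)
              exact mul_le_mul_of_nonneg_right hyu (by positivity)
          _ = (t ^ u * t ^ (-u)) * ((t + t⁻¹) * (s + s⁻¹) * (C * t ^ u * sg s 0)) := by
              rw [e0]; ring
          _ = _ := by rw [← zpow_add₀ ht0.ne']; simp
      · rw [if_neg h.ne']
        simp only [if_neg (show ¬ i + 1 ≤ n / 2 by omega), if_neg (show ¬ i ≤ n / 2 by omega)]
        calc _ = (t ^ (-(u + 1)) + t ^ (-(u + -1))) *
              ((if l = 0 then a else 1) * (gm A B s (l + 1) + gm A B s (l + -1))) := by ring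
          _ = ((t + t⁻¹) * t ^ (-u)) *
              ((if l = 0 then a else 1) * (gm A B s (l + 1) + gm A B s (l + -1))) := by rw [tu']
          _ ≤ ((t + t⁻¹) * t ^ (-u)) * ((s + s⁻¹) * gm A B s l) :=
              mul_le_mul_of_nonneg_left hg (by positivity)
          _ = _ := by ring)
    n 0 (by omega)
  rw [PC_eq]
  calc _ ≤ ∑ c : Fin (n + 1), ((t + t⁻¹) * (s + s⁻¹)) ^ n * C := by
        refine Finset.sum_le_sum fun c _ => (key _).trans ?_
        refine mul_le_mul_of_nonneg_left ?_ (by positivity)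
        simp only [hG]
        rw [if_pos (by omega), sg, if_pos (by positivity), mul_assoc]
        refine mul_le_of_le_one_right hC0.le ?_
        rw [zpow_neg, ← div_eq_mul_inv]
        simp only [zpow_natCast]
        exact div_le_one_of_le₀ (pow_le_pow_left₀ ht0.le hst _) (by positivity)
    _ = _ := by
        rw [Finset.sum_const, Finset.card_univ, Fintype.card_fin, nsmul_eq_mul]; push_cast; ring

/-! ### Asymptotics -/

lemma log_mu (x : ℝ) (hx : 0 < x) : Real.log (mu x) = Real.log (x + 1) - 1 / 2 * Real.log x := by
  have hs := Real.sqrt_pos.2 hx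
  have : mu x = (x + 1) / √x := by
    unfold mu
    field_simp
    rw [Real.sq_sqrt hx.le]
  rw [this, Real.log_div (by positivity) (by positivity), Real.log_sqrt hx.le]
  ring

lemma tendsto_const_div (c : ℝ) : Tendsto (fun n : ℕ => c / (n : ℝ)) atTop (nhds 0) :=
  tendsto_const_div_atTop_nhds_zero_nat c

lemma tendsto_log_div (j : ℕ) :
    Tendsto (fun n : ℕ => Real.log (j * n + 1) / (n : ℝ)) atTop (nhds 0) := by
  have h1 : Tendsto (fun n : ℕ => Real.log (n : ℝ) / (n : ℝ)) atTop (nhds 0) := by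
    have := Real.isLittleO_log_id_atTop.tendsto_div_nhds_zero
    exact this.comp tendsto_natCast_atTop_atTop
  have h2 : Tendsto (fun n : ℕ => Real.log (j + 1 : ℝ) / n + Real.log (n : ℝ) / (n : ℝ)) atTop
      (nhds 0) := by
    simpa using (tendsto_const_div (Real.log (j + 1 : ℝ))).add h1
  refine tendsto_of_tendsto_of_tendsto_of_le_of_le' tendsto_const_nhds h2 ?_ ?_
  · filter_upwards with n
    refine div_nonneg (Real.log_nonneg ?_) (by positivity)
    have : (0 : ℝ) ≤ j * n := by positivity
    linarith
  · filter_upwards [eventually_ge_atTop 1] with n hn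
    have hn' : (1 : ℝ) ≤ n := by exact_mod_cast hn
    rw [← add_div, ← Real.log_mul (by positivity) (by positivity)]
    gcongr
    nlinarith

theorem psiC_main (a y : ℝ) (ha : 0 < a) (hy : 0 < y) :
    Tendsto (fun n : ℕ => Real.log (PC n a y) / (2 * n)) atTop
      (nhds (1 / 2 * Real.log (mu (max 1 y)) + 1 / 2 * Real.log (mu (max (max 1 y) (a - 1))))) := by
  set Y := max 1 y with hY
  set M := max Y (a - 1) with hM
  have hY1 : 1 ≤ Y := le_max_left _ _
  have hYM : Y ≤ M := le_max_left _ _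
  have hY0 : 0 < Y := by linarith
  have hM0 : 0 < M := by linarith
  have mY := mu_pos Y hY0
  have mM := mu_pos M hM0
  have hposev : ∀ᶠ n in atTop, 0 < PC n a y := by
    obtain ⟨s0, ε, X, hε, hX, -, H⟩ := PC_lower a y ha hy 1 one_pos
    filter_upwards [eventually_ge_atTop (2 * s0 + 4)] with n hn
    exact lt_of_lt_of_le (by positivity) (H n (by omega) (by omega))
  rw [tendsto_order]
  constructor
  · intro x hx
    -- choice of the block length
    have hlim : Tendsto (fun k : ℕ => 1 / 2 * Real.log (mu Y) + 1 / 2 * Real.log (mu M)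
        - (1 / 2 * Real.log (1 + a) / k + Real.log ((2 : ℕ) * k + 1) / k)) atTop
        (nhds (1 / 2 * Real.log (mu Y) + 1 / 2 * Real.log (mu M) - (0 + 0))) :=
      tendsto_const_nhds.sub ((tendsto_const_div _).add (tendsto_log_div 2))
    rw [add_zero, sub_zero] at hlim
    obtain ⟨k, hkx, hk⟩ := ((hlim.eventually_const_lt hx).and (eventually_gt_atTop 0)).exists
    have hk' : (0 : ℝ) < k := by exact_mod_cast hk
    obtain ⟨s0, ε, X, hε, hX, hXge, H⟩ := PC_lower a y ha hy k hk
    have hlogX : x < Real.log X / (8 * k) := by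
      refine hkx.trans_le ?_
      have h1 := Real.log_le_log (by positivity) hXge
      rw [Real.log_div (by positivity) (by positivity), Real.log_mul (by positivity) (by positivity),
        Real.log_pow, Real.log_pow, Real.log_pow, Real.log_mul mY.ne' mM.ne'] at h1
      push_cast at h1 ⊢
      rw [le_div_iff₀ (by positivity)]
      refine le_trans (le_of_eq ?_) h1
      field_simp
      ring
    have hlim2 : Tendsto (fun n : ℕ => Real.log X / (8 * k)
        + ((Real.log ε - (s0 + 2) * |Real.log X|) / 2) / n) atTop (nhds (Real.log X / (8 * k) + 0)) :=
      tendsto_const_nhds.add (tendsto_const_div _)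
    rw [add_zero] at hlim2
    filter_upwards [hlim2.eventually_const_lt hlogX, eventually_ge_atTop (2 * s0 + 4)] with n h1 hn
    refine h1.trans_le ?_
    have hn0 : (0 : ℝ) < n := by exact_mod_cast (show 0 < n by omega)
    have h2 := Real.log_le_log (by positivity) (H n (by omega) (by omega))
    rw [Real.log_mul (by positivity) (by positivity), Real.log_pow] at h2
    set q := (n / 2 - s0) / (2 * k) with hq
    have hq1 : (q : ℝ) * (4 * k) ≤ n := by
      have := Nat.div_mul_le_self (n / 2 - s0) (2 * k)
      rw [← hq] at this
      have h3 : q * (4 * k) ≤ n := by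
        have : q * (4 * k) = 2 * (q * (2 * k)) := by ring
        omega
      exact_mod_cast h3
    have hq2 : (n : ℝ) ≤ (q + s0 + 2) * (4 * k) := by
      have h4 := Nat.lt_div_mul_add (a := n / 2 - s0) (show 0 < 2 * k by omega)
      rw [← hq] at h4
      have h3 : n ≤ (q + s0 + 2) * (4 * k) := by
        have e : (q + s0 + 2) * (4 * k) = 2 * (q * (2 * k)) + 4 * (s0 * k) + 8 * k := by ring
        have : s0 ≤ s0 * k := Nat.le_mul_of_pos_right _ hk
        omega
      exact_mod_cast h3
    have h5 : (n : ℝ) / (4 * k) * Real.log X - (s0 + 2) * |Real.log X| ≤ q * Real.log X := by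
      have e1 : (q : ℝ) ≤ n / (4 * k) := by rw [le_div_iff₀ (by positivity)]; exact hq1
      have e2 : (n : ℝ) / (4 * k) ≤ q + s0 + 2 := by rw [div_le_iff₀ (by positivity)]; exact hq2
      have e3 : ((n : ℝ) / (4 * k) - q) * Real.log X ≤ (s0 + 2) * |Real.log X| :=
        (mul_le_mul_of_nonneg_left (le_abs_self _) (by linarith)).trans
          (mul_le_mul_of_nonneg_right (by linarith) (abs_nonneg _))
      linarith
    rw [le_div_iff₀ (by positivity)]
    calc (Real.log X / (8 * k) + ((Real.log ε - (s0 + 2) * |Real.log X|) / 2) / n) * (2 * n)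
        = (n : ℝ) / (4 * k) * Real.log X - (s0 + 2) * |Real.log X| + Real.log ε := by
          field_simp; ring
      _ ≤ _ := by linarith
  · intro x hx
    have hsM := Real.sqrt_pos.2 hM0
    have hcont : ContinuousAt (fun s : ℝ => 1 / 2 * Real.log (mu Y) + 1 / 2 * Real.log (s + s⁻¹)) √M := by
      have : √M + (√M)⁻¹ ≠ 0 := by positivity
      have h0 := hsM.ne'
      fun_prop (disch := assumption)
    have hev : ∀ᶠ s in nhdsWithin √M (Set.Ioi √M),
        1 / 2 * Real.log (mu Y) + 1 / 2 * Real.log (s + s⁻¹) < x :=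
      (hcont.tendsto.mono_left nhdsWithin_le_nhds).eventually_lt_const hx
    obtain ⟨s, hsx, hs⟩ := (hev.and self_mem_nhdsWithin).exists
    have hs' : √M < s := hs
    have hs0 : 0 < s := hsM.trans hs'
    have has : a < s ^ 2 + 1 := by
      have h1 : M < s ^ 2 := by
        rw [← Real.sq_sqrt hM0.le]; exact pow_lt_pow_left₀ hs' hsM.le (by norm_num)
      have : a - 1 ≤ M := le_max_right _ _
      linarith
    obtain ⟨C, hC, H⟩ := PC_upper a y s ha hy ((Real.sqrt_le_sqrt hYM).trans hs'.le) has
    have hlim : Tendsto (fun n : ℕ => 1 / 2 * Real.log (mu Y) + 1 / 2 * Real.log (s + s⁻¹)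
        + (1 / 2 * Real.log C / n + 1 / 2 * (Real.log ((1 : ℕ) * n + 1) / n))) atTop
        (nhds (1 / 2 * Real.log (mu Y) + 1 / 2 * Real.log (s + s⁻¹) + (0 + 1 / 2 * 0))) :=
      tendsto_const_nhds.add ((tendsto_const_div _).add ((tendsto_log_div 1).const_mul _))
    rw [mul_zero, add_zero, add_zero] at hlim
    filter_upwards [hlim.eventually_lt_const hsx, eventually_ge_atTop 1, hposev] with n h1 hn hp
    refine lt_of_le_of_lt ?_ h1
    have hn0 : (0 : ℝ) < n := by exact_mod_cast (show 0 < n by omega)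
    have h2 := Real.log_le_log hp (H n hn)
    rw [Real.log_mul (by positivity) (by positivity), Real.log_mul (by positivity) (by positivity),
      Real.log_pow, Real.log_mul mY.ne' (by positivity)] at h2
    rw [div_le_iff₀ (by positivity)]
    refine h2.trans (le_of_eq ?_)
    push_cast
    rw [one_mul]
    field_simp
    ring

/-- Theorem 2 (`ψ^C`): the free energy of centred staircase polygons exists and is given
explicitly in the four regions of the `(a,y)`-quarter-plane. -/
theorem psiC_exists (a y : ℝ) (ha : 0 < a) (hy : 0 < y) :
    Tendsto (fun n : ℕ => Real.log (PC n a y) / (2 * n)) atTop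
      (nhds (if y ≤ 1 then
            (if a ≤ 2 then Real.log 2
             else (1/2) * Real.log 2 + (1/2) * Real.log a - (1/4) * Real.log (a-1))
          else
            (if a ≤ y + 1 then Real.log (y+1) - (1/2) * Real.log y
             else (1/2) * Real.log a - (1/4) * Real.log (a-1)
                  + (1/2) * Real.log (y+1) - (1/4) * Real.log y))) := by
  have h := psiC_main a y ha hy
  convert h using 2
  split_ifs with h1 h2 h2
  · rw [max_eq_left h1, max_eq_left (by linarith), log_mu 1 one_pos]
    norm_num
    ring
  · rw [max_eq_left h1, max_eq_right (by linarith), log_mu 1 one_pos, log_mu (a - 1) (by linarith)]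
    norm_num
    ring
  · rw [max_eq_right (by linarith), max_eq_left (by linarith), log_mu y hy]
    ring
  · rw [max_eq_right (by linarith : (1 : ℝ) ≤ y), max_eq_right (by linarith), log_mu y hy,
      log_mu (a - 1) (by linarith)]
    norm_num
    ring
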